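/- For every natural number n ≥ 1 and every complex number z, if the derivative of the n-th Chebyshev polynomial of the first kind vanishes at z, then T_n(z) = 1 or T_n(z) = −1; i.e., the Chebyshev polynomial T_n has exactly the two finite critical values ±1. -/

import Mathlib

/-- For every `n ≥ 1`, if the derivative of the `n`-th Chebyshev
polynomial of the first kind (over `ℂ`) vanishes at `z`, then `T_n(z) = 1` or
`T_n(z) = -1`; i.e. `T_n` has exactly the two finite critical values `±1`. -/
theorem chebyshev_two_critical_values (n : ℕ) (hn : 1 ≤ n) (z : ℂ)
    (h : (Polynomial.derivative (Polynomial.Chebyshev.T ℂ (n : ℤ))).eval z = 0) :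
    (Polynomial.Chebyshev.T ℂ (n : ℤ)).eval z = 1 ∨
      (Polynomial.Chebyshev.T ℂ (n : ℤ)).eval z = -1 := by
  obtain ⟨θ, rfl⟩ := Complex.cos_surjective z
  have hn' : (n : ℂ) ≠ 0 := by exact_mod_cast (by omega : n ≠ 0)
  have hU : (Polynomial.Chebyshev.U ℂ ((n : ℤ) - 1)).eval (Complex.cos θ) = 0 := by
    simpa [Polynomial.Chebyshev.T_derivative_eq_U, hn'] using h
  have h_sin : Complex.sin (n * θ) = 0 := by
    simpa [hU] using (Polynomial.Chebyshev.U_complex_cos θ ((n : ℤ) - 1)).symm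
  rw [Polynomial.Chebyshev.T_complex_cos, ← sq_eq_one_iff]
  simpa [h_sin] using Complex.sin_sq_add_cos_sq (n * θ)
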